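/- Let (B,·,∘) be a skew left brace with associated solution (B,λ,ρ), and suppose that (B,·_op,∘) is a bi-skew left brace, where a·_op b = b·a. Then: (i) Ker ρ = {a ∈ B : ρ_a = id} is an ideal of (B,·,∘), i.e. it is a normal subgroup of (B,·), a normal subgroup of (B,∘), and λ_x(Ker ρ) ⊆ Ker ρ for all x ∈ B; (ii) the cosets of Ker ρ coincide with the classes of the relation ∽ given by x∽y ⟺ ρ_x = ρ_y; explicitly, x∘ȳ ∈ Ker ρ if and only if ρ_x = ρ_y. -/

import Mathlib

/-- A skew left brace: two group operations `·` (mul) and `∘` (circ) on `B`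
sharing the neutral element `1`, satisfying
`a ∘ (b · c) = (a ∘ b) · a⁻¹ · (a ∘ c)`. -/
structure SkewLeftBrace (B : Type*) where
  mul : B → B → B
  one : B
  inv : B → B
  circ : B → B → B
  oinv : B → B
  mul_assoc : ∀ a b c, mul (mul a b) c = mul a (mul b c)
  one_mul : ∀ a, mul one a = a
  mul_one : ∀ a, mul a one = a
  inv_mul : ∀ a, mul (inv a) a = one
  mul_inv : ∀ a, mul a (inv a) = one
  circ_assoc : ∀ a b c, circ (circ a b) c = circ a (circ b c)
  one_circ : ∀ a, circ one a = a
  circ_one : ∀ a, circ a one = a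
  oinv_circ : ∀ a, circ (oinv a) a = one
  circ_oinv : ∀ a, circ a (oinv a) = one
  compat : ∀ a b c, circ a (mul b c) = mul (mul (circ a b) (inv a)) (circ a c)

namespace SkewLeftBrace

variable {B : Type*}

/-- `λ_a(b) = a⁻¹ · (a ∘ b)`. -/
def lam (S : SkewLeftBrace B) (a b : B) : B := S.mul (S.inv a) (S.circ a b)

/-- `ρ_b(a) = (λ_a(b))‾ ∘ a ∘ b`, so that `(B, lam, rho)` is the solution
associated to the skew left brace. -/
def rho (S : SkewLeftBrace B) (b a : B) : B :=
  S.circ (S.circ (S.oinv (S.lam a b)) a) b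

/-- `(B, ·, ∘)` is a bi-skew left brace: `(B, ∘, ·)` is also a skew left brace,
i.e. `a · (b ∘ c) = (a · b) ∘ ā ∘ (a · c)`. -/
def IsBiSkew (S : SkewLeftBrace B) : Prop :=
  ∀ a b c, S.mul a (S.circ b c) =
    S.circ (S.circ (S.mul a b) (S.oinv a)) (S.mul a c)


variable {B : Type*}

theorem inv_mul_cancel_left' (S : SkewLeftBrace B) (a b : B) :
    S.mul (S.inv a) (S.mul a b) = b := by
  rw [← S.mul_assoc, S.inv_mul, S.one_mul]

theorem mul_inv_cancel_left' (S : SkewLeftBrace B) (a b : B) :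
    S.mul a (S.mul (S.inv a) b) = b := by
  rw [← S.mul_assoc, S.mul_inv, S.one_mul]

theorem oinv_circ_cancel_left (S : SkewLeftBrace B) (a b : B) :
    S.circ (S.oinv a) (S.circ a b) = b := by
  rw [← S.circ_assoc, S.oinv_circ, S.one_circ]

theorem circ_oinv_cancel_left (S : SkewLeftBrace B) (a b : B) :
    S.circ a (S.circ (S.oinv a) b) = b := by
  rw [← S.circ_assoc, S.circ_oinv, S.one_circ]

theorem eq_oinv_circ_iff (S : SkewLeftBrace B) (a b c : B) :
    a = S.circ (S.oinv b) c ↔ S.circ b a = c := by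
  constructor
  · rintro rfl
    exact S.circ_oinv_cancel_left b c
  · rintro rfl
    exact (S.oinv_circ_cancel_left b a).symm

theorem eq_inv_of_mul_eq_one (S : SkewLeftBrace B) {a b : B} (h : S.mul a b = S.one) :
    b = S.inv a := by
  rw [← S.inv_mul_cancel_left' a b, h, S.mul_one]

theorem mul_lam (S : SkewLeftBrace B) (a b : B) : S.mul a (S.lam a b) = S.circ a b :=
  S.mul_inv_cancel_left' a _

theorem lam_mul (S : SkewLeftBrace B) (a b c : B) :
    S.lam a (S.mul b c) = S.mul (S.lam a b) (S.lam a c) := by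
  simp only [lam, S.compat, S.mul_assoc]

theorem lam_circ (S : SkewLeftBrace B) (a b c : B) :
    S.lam (S.circ a b) c = S.lam a (S.lam b c) := by
  have h : S.circ (S.circ a b) c = S.mul (S.circ a b) (S.lam a (S.lam b c)) := by
    rw [S.circ_assoc, ← S.mul_lam b c, S.compat, S.mul_assoc]
    rfl
  rw [lam, h, S.inv_mul_cancel_left']

theorem circ_lam_oinv (S : SkewLeftBrace B) (a b : B) :
    S.circ a (S.lam (S.oinv a) b) = S.mul a b := by
  rw [← S.mul_lam, ← S.lam_circ, S.circ_oinv, lam, S.one_circ,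
    ← S.eq_inv_of_mul_eq_one (S.one_mul S.one), S.one_mul]

theorem lam_circ_rho (S : SkewLeftBrace B) (a b : B) :
    S.circ (S.lam a b) (S.rho b a) = S.circ a b := by
  rw [rho, S.circ_assoc, S.circ_oinv_cancel_left]

theorem lam_circ_lam_rho (S : SkewLeftBrace B) (a b c : B) :
    S.circ (S.lam a b) (S.lam (S.rho b a) c) = S.lam a (S.circ b c) := by
  rw [← S.mul_lam, ← S.lam_circ, S.lam_circ_rho, S.lam_circ, ← S.lam_mul, S.mul_lam]

theorem rho_circ (S : SkewLeftBrace B) (a b c : B) :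
    S.rho (S.circ b c) a = S.rho c (S.rho b a) := by
  symm
  rw [rho.eq_1 S (S.circ b c), S.circ_assoc, S.eq_oinv_circ_iff, ← S.lam_circ_lam_rho,
    S.circ_assoc, S.lam_circ_rho, ← S.circ_assoc, S.lam_circ_rho, S.circ_assoc]

theorem rho_one (S : SkewLeftBrace B) (a : B) : S.rho S.one a = a := by
  symm
  rw [rho, S.circ_assoc, S.eq_oinv_circ_iff, S.circ_one, lam, S.circ_one, S.inv_mul, S.one_circ]

/-- The kernel of `ρ` consists of the `k` with `b · k = k ∘ b` for all `b`. -/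
theorem rho_eq_id_iff (S : SkewLeftBrace B) (k : B) :
    (∀ b, S.rho k b = b) ↔ ∀ b, S.mul b k = S.circ k b := by
  have key : ∀ b, S.rho k b = b ↔ S.circ (S.lam b k) b = S.circ b k := by
    intro b
    rw [eq_comm, rho, S.circ_assoc, S.eq_oinv_circ_iff]
  constructor
  · intro h b
    have hb := (key (S.oinv b)).1 (h _)
    have hl : S.lam (S.oinv b) k = S.circ (S.oinv b) (S.circ k b) := by
      rw [← S.circ_assoc, ← hb, S.circ_assoc, S.oinv_circ, S.circ_one]
    rw [← S.circ_lam_oinv, hl, S.circ_oinv_cancel_left]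
  · intro h b
    have hl : S.lam b k = S.circ b (S.circ k (S.oinv b)) := by
      have hb := S.circ_lam_oinv (S.oinv b) k
      rw [← h, ← hb, S.circ_oinv_cancel_left]
      rw [← S.circ_one (S.oinv (S.oinv b)), ← (S.eq_oinv_circ_iff b _ _).2 (S.oinv_circ b)]
    rw [key, hl, S.circ_assoc, S.circ_assoc, S.oinv_circ, S.circ_one]

theorem rho_oinv_rho (S : SkewLeftBrace B) (a b : B) : S.rho (S.oinv a) (S.rho a b) = b := by
  rw [← S.rho_circ, S.circ_oinv, S.rho_one]

theorem rho_rho_oinv (S : SkewLeftBrace B) (a b : B) : S.rho a (S.rho (S.oinv a) b) = b := by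
  rw [← S.rho_circ, S.oinv_circ, S.rho_one]

theorem rho_conj_eq_id (S : SkewLeftBrace B) {a : B} (x : B) (ha : ∀ b, S.rho a b = b) (b : B) :
    S.rho (S.circ (S.circ x a) (S.oinv x)) b = b := by
  rw [S.rho_circ, S.rho_circ, ha, S.rho_oinv_rho]

theorem rho_oinv_eq_id (S : SkewLeftBrace B) {a : B} (ha : ∀ b, S.rho a b = b) (b : B) :
    S.rho (S.oinv a) b = b := by
  rw [← ha (S.rho (S.oinv a) b), S.rho_rho_oinv]

/-- On the kernel of `ρ`, the map `λ_x` is conjugation by `x` in `(B, ∘)`. -/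
theorem lam_eq_conj (S : SkewLeftBrace B) {a : B} (x : B) (ha : ∀ b, S.rho a b = b) :
    S.lam x a = S.circ (S.circ x a) (S.oinv x) := by
  rw [← S.lam_circ_rho x a, ha, S.circ_assoc, S.circ_oinv, S.circ_one]

/-- Normality of the kernel of `ρ` in `(B, ·)` uses that the opposite brace is bi-skew. -/
theorem rho_mul_conj_eq_id (S : SkewLeftBrace B)
    (hop : ∀ a b c, S.mul (S.circ b c) a =
        S.circ (S.circ (S.mul b a) (S.oinv a)) (S.mul c a))
    {a : B} (x : B) (ha : ∀ b, S.rho a b = b) :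
    ∀ b, S.rho (S.mul (S.mul x a) (S.inv x)) b = b := by
  rw [S.rho_eq_id_iff] at ha ⊢
  have key : ∀ b, S.mul b (S.mul (S.mul x a) (S.inv x)) =
      S.circ (S.circ (S.mul a (S.inv x)) (S.oinv (S.inv x))) b := by
    intro b
    rw [← S.mul_assoc, ← S.mul_assoc, ha, hop, S.mul_assoc b, S.mul_inv, S.mul_one]
  intro b
  have h1 := key S.one
  rw [S.one_mul, S.circ_one] at h1
  rw [key, ← h1]

/-- if the opposite skew left brace `(B, ·_op, ∘)` is a bi-skew
left brace (the hypothesis `hop` is the bi-skew identity for `·_op`), then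
`Ker ρ = {a : ρ_a = id}` is an ideal of `(B,·,∘)` and its cosets are exactly
the classes of the relation `x ∽ y ⟺ ρ_x = ρ_y`. -/
theorem kerRho_ideal_of_op_biSkew (S : SkewLeftBrace B)
    (hop : ∀ a b c, S.mul (S.circ b c) a =
        S.circ (S.circ (S.mul b a) (S.oinv a)) (S.mul c a)) :
    ((∀ b, S.rho S.one b = b) ∧
     (∀ a a', (∀ b, S.rho a b = b) → (∀ b, S.rho a' b = b) →
        ∀ b, S.rho (S.mul a a') b = b) ∧
     (∀ a, (∀ b, S.rho a b = b) → ∀ b, S.rho (S.inv a) b = b) ∧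
     (∀ a x, (∀ b, S.rho a b = b) →
        ∀ b, S.rho (S.mul (S.mul x a) (S.inv x)) b = b) ∧
     (∀ a a', (∀ b, S.rho a b = b) → (∀ b, S.rho a' b = b) →
        ∀ b, S.rho (S.circ a a') b = b) ∧
     (∀ a, (∀ b, S.rho a b = b) → ∀ b, S.rho (S.oinv a) b = b) ∧
     (∀ a x, (∀ b, S.rho a b = b) →
        ∀ b, S.rho (S.circ (S.circ x a) (S.oinv x)) b = b) ∧
     (∀ x a, (∀ b, S.rho a b = b) → ∀ b, S.rho (S.lam x a) b = b)) ∧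
    (∀ x y, (∀ b, S.rho (S.circ x (S.oinv y)) b = b) ↔ S.rho x = S.rho y) := by
  refine ⟨⟨S.rho_one, ?_, ?_, fun a x ha => S.rho_mul_conj_eq_id hop x ha, ?_,
    fun a ha => S.rho_oinv_eq_id ha, fun a x ha => S.rho_conj_eq_id x ha, ?_⟩, ?_⟩
  · intro a a' ha ha' b
    rw [(S.rho_eq_id_iff a').1 ha', S.rho_circ, ha', ha]
  · intro a ha
    have h : S.oinv a = S.inv a := by
      apply S.eq_inv_of_mul_eq_one
      rw [(S.rho_eq_id_iff _).1 (S.rho_oinv_eq_id ha), S.oinv_circ]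
    rw [← h]
    exact S.rho_oinv_eq_id ha
  · intro a a' ha ha' b
    rw [S.rho_circ, ha, ha']
  · intro x a ha
    rw [S.lam_eq_conj x ha]
    exact S.rho_conj_eq_id x ha
  · intro x y
    constructor
    · intro h
      funext b
      rw [← S.rho_rho_oinv y (S.rho x b), ← S.rho_circ b x, h]
    · intro h b
      rw [S.rho_circ, h, S.rho_oinv_rho]
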